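/- Let α > 1, C > 0 and λ > 0, and let ℓ : ℕ+ → ℕ be the Elias codelength function ℓ(j) = ⌊log j + 2·log(1 + log j) + 1⌋. For a probability mass function p on ℕ+ satisfying p(x) ≤ C/x^α for all x, and for n ≥ 1, let L_n(p) = Σ_{j=1}^n Σ_{x ∈ ℕ+, x > λ j^{1/α}} p(x)·ℓ(x) (this is the expected total Elias codelength of the censored symbols, at cutoffs K_j = λ j^{1/α}, for n i.i.d. draws from p). Then limsup_{n→∞} [ sup_p L_n(p) ] / ( n^{1/α} · log n ) ≤ 2C/((α−1)·λ^{α−1}), where the supremum is over all probability mass functions p on ℕ+ with p(x) ≤ C/x^α for all x. -/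

import Mathlib

open scoped ENNReal BigOperators

noncomputable section

/-- `p` is a probability mass function on `α`. -/
def IsPmf {α : Type*} (p : α → ℝ) : Prop := (∀ a, 0 ≤ p a) ∧ HasSum p 1

/-- The `n`-fold product probability mass function. -/
def prodPmf {α : Type*} (p : α → ℝ) (n : ℕ) : (Fin n → α) → ℝ :=
  fun x => ∏ i, p (x i)

/-- base-2 logarithm of the ratio `a / b`, valued in `[0,∞]`:
it is `⊤` when `b = 0 < a`, and clipped at `0` from below (which does not affect
the suprema defining minimax regret, which are always nonnegative). -/
def regretTerm (a b : ℝ) : ℝ≥0∞ :=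
  if a ≤ 0 then 0 else if b ≤ 0 then ⊤ else ENNReal.ofReal (Real.logb 2 (a / b))

/-- Minimax regret (base 2) of the class `Λ` for word length `n`, valued in `[0,∞]`. -/
def minimaxRegret {α : Type*} (Λ : Set (α → ℝ)) (n : ℕ) : ℝ≥0∞ :=
  ⨅ (Q : (Fin n → α) → ℝ) (_ : IsPmf Q),
    ⨆ (x : Fin n → α), ⨆ P ∈ Λ, regretTerm (prodPmf P n x) (Q x)

/- Kullback-Leibler divergence `D(p‖q)` in base 2, valued in `[0,∞]`.
It is `⊤` unless `q` dominates `p`; otherwise it is computed through the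
pointwise-nonnegative decomposition `p log(p/q) + q - p` (summing to
`Σ p log(p/q)` since `Σ p = Σ q = 1`), converted from nats to bits. -/
open Classical in
def klDiv2 {α : Type*} (p q : α → ℝ) : ℝ≥0∞ :=
  if ∃ a, q a = 0 ∧ 0 < p a then ⊤
  else (∑' a, ENNReal.ofReal (p a * Real.log (p a / q a) + q a - p a)) /
       ENNReal.ofReal (Real.log 2)

/-- Minimax redundancy (base 2) of the class `Λ` for word length `n`, valued in `[0,∞]`. -/
def minimaxRedundancy {α : Type*} (Λ : Set (α → ℝ)) (n : ℕ) : ℝ≥0∞ :=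
  ⨅ (Q : (Fin n → α) → ℝ) (_ : IsPmf Q), ⨆ P ∈ Λ, klDiv2 (prodPmf P n) Q

/-- The envelope class defined by the envelope function `f`. -/
def envClass (f : ℕ+ → ℝ) : Set (ℕ+ → ℝ) := {P | IsPmf P ∧ ∀ k, P k ≤ f k}

/-- The Elias codelength function (as a real number). -/
def elias (j : ℕ+) : ℝ :=
  (⌊Real.logb 2 (j : ℝ) + 2 * Real.logb 2 (1 + Real.logb 2 (j : ℝ)) + 1⌋ : ℤ)

/-- The function `x ↦ x ^ (-α) (a log x + A)`. -/
def powLogDensity (α a A x : ℝ) : ℝ := x ^ (-α) * (a * Real.log x + A)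

/-- The tail integral `∫_x^∞` of `powLogDensity α a A`. -/
def powLogTail (α a A x : ℝ) : ℝ :=
  x ^ (1 - α) * (a * Real.log x / (α - 1) + (A + a / (α - 1)) / (α - 1))

lemma powLogDensity_nonneg {α a A x : ℝ} (ha : 0 ≤ a) (hA : 0 ≤ A) (hx : 1 ≤ x) :
    0 ≤ powLogDensity α a A x := by
  have := Real.log_nonneg hx
  unfold powLogDensity
  positivity

lemma powLogTail_nonneg {α a A x : ℝ} (hα : 1 < α) (ha : 0 ≤ a) (hA : 0 ≤ A) (hx : 1 ≤ x) :
    0 ≤ powLogTail α a A x := by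
  have := Real.log_nonneg hx
  have : 0 < α - 1 := by linarith
  unfold powLogTail
  positivity

lemma hasDerivAt_powLogDensity (α a A : ℝ) {x : ℝ} (hx : 0 < x) :
    HasDerivAt (powLogDensity α a A)
      (x ^ (-α - 1) * (a - α * (a * Real.log x + A))) x := by
  have h1 := Real.hasDerivAt_rpow_const (p := -α) (Or.inl hx.ne')
  have h2 := ((Real.hasDerivAt_log hx.ne').const_mul a).add_const A
  refine (h1.mul h2).congr_deriv ?_
  have : x ^ (-α) = x ^ (-α - 1) * x := by
    rw [Real.rpow_sub_one hx.ne']; field_simp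
  rw [this]
  field_simp
  ring

lemma hasDerivAt_powLogTail {α : ℝ} (hα : 1 < α) (a A : ℝ) {x : ℝ} (hx : 0 < x) :
    HasDerivAt (powLogTail α a A) (-powLogDensity α a A x) x := by
  have h1 := Real.hasDerivAt_rpow_const (p := 1 - α) (Or.inl hx.ne')
  have h2 := (((Real.hasDerivAt_log hx.ne').const_mul a).div_const (α - 1)).add_const
    ((A + a / (α - 1)) / (α - 1))
  refine (h1.mul h2).congr_deriv ?_
  have hb : α - 1 ≠ 0 := by linarith
  have e1 : x ^ (1 - α) = x ^ (-α) * x := by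
    rw [show 1 - α = -α + 1 by ring, Real.rpow_add_one hx.ne']
  have e2 : x ^ (1 - α - 1) = x ^ (-α) := by congr 1; ring
  rw [powLogDensity, e1, e2]
  field_simp
  ring

lemma powLogDensity_antitoneOn {α a A : ℝ} (hα : 1 < α) (ha : 0 ≤ a) (hA : a ≤ A) :
    AntitoneOn (powLogDensity α a A) (Set.Ici 1) := by
  have hd : ∀ x : ℝ, 1 ≤ x → HasDerivAt (powLogDensity α a A) _ x :=
    fun x hx => hasDerivAt_powLogDensity α a A (by linarith)
  refine antitoneOn_of_deriv_nonpos (convex_Ici 1)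
    (fun x hx => (hd x hx).continuousAt.continuousWithinAt) ?_ ?_
  · intro x hx
    rw [interior_Ici] at hx
    exact (hd x hx.le).differentiableAt.differentiableWithinAt
  · intro x hx
    rw [interior_Ici] at hx
    have hx' : (1 : ℝ) ≤ x := le_of_lt hx
    rw [(hd x hx').deriv]
    have hl := Real.log_nonneg hx'
    have hp : 0 ≤ a * Real.log x := mul_nonneg ha hl
    refine mul_nonpos_of_nonneg_of_nonpos (by positivity) ?_
    nlinarith

lemma powLogTail_antitoneOn {α a A : ℝ} (hα : 1 < α) (ha : 0 ≤ a) (hA : 0 ≤ A) :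
    AntitoneOn (powLogTail α a A) (Set.Ici 1) := by
  have hd : ∀ x : ℝ, 1 ≤ x → HasDerivAt (powLogTail α a A) _ x :=
    fun x hx => hasDerivAt_powLogTail hα a A (by linarith)
  refine antitoneOn_of_deriv_nonpos (convex_Ici 1)
    (fun x hx => (hd x hx).continuousAt.continuousWithinAt) ?_ ?_
  · intro x hx
    rw [interior_Ici] at hx
    exact (hd x hx.le).differentiableAt.differentiableWithinAt
  · intro x hx
    rw [interior_Ici] at hx
    have hx' : (1 : ℝ) ≤ x := le_of_lt hx
    rw [(hd x hx').deriv]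
    linarith [powLogDensity_nonneg (α := α) ha hA hx']

lemma powLogDensity_add_one_le {α a A x : ℝ} (hα : 1 < α) (ha : 0 ≤ a) (hA : a ≤ A)
    (hx : 1 ≤ x) :
    powLogDensity α a A (x + 1) ≤ powLogTail α a A x - powLogTail α a A (x + 1) := by
  have hd : ∀ y : ℝ, 1 ≤ y → HasDerivAt (powLogTail α a A) _ y :=
    fun y hy => hasDerivAt_powLogTail hα a A (by linarith)
  obtain ⟨c, hc, hc'⟩ := exists_hasDerivAt_eq_slope (powLogTail α a A)
    (fun y => -powLogDensity α a A y) (lt_add_one x)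
    (fun y hy => (hd y (hx.trans hy.1)).continuousAt.continuousWithinAt)
    (fun y hy => hd y (hx.trans hy.1.le))
  have h1 : powLogDensity α a A (x + 1) ≤ powLogDensity α a A c :=
    powLogDensity_antitoneOn hα ha hA (hx.trans hc.1.le) (by simp; linarith) hc.2.le
  rw [add_sub_cancel_left, div_one] at hc'
  linarith

lemma sum_range_powLogDensity_le {α a A K : ℝ} (hα : 1 < α) (ha : 0 ≤ a) (hA : a ≤ A)
    (hK : 0 < K) (N : ℕ) :
    ∑ i ∈ Finset.range N, (if K < (i : ℝ) + 1 then powLogDensity α a A (i + 1) else 0) ≤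
      if (N : ℝ) ≤ K then 0
      else powLogDensity α a A (max 1 K) + powLogTail α a A (max 1 K) - powLogTail α a A N := by
  induction N with
  | zero => simp [hK.le]
  | succ N ih =>
    rw [Finset.sum_range_succ]
    push_cast
    by_cases h : (N : ℝ) ≤ K
    · rw [if_pos h] at ih
      by_cases h' : K < (N : ℝ) + 1
      · rw [if_pos h', if_neg (not_le.2 h')]
        have hM : max 1 K ≤ (N : ℝ) + 1 := max_le (by simp) h'.le
        have h1 : (1 : ℝ) ≤ max 1 K := le_max_left _ _
        have h2 := powLogDensity_antitoneOn hα ha hA h1 (h1.trans hM) hM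
        have h3 := powLogTail_antitoneOn hα ha (ha.trans hA) h1 (h1.trans hM) hM
        linarith
      · rw [if_neg h', if_pos (not_lt.1 h')]
        linarith
    · rw [if_neg h] at ih
      have h' : K < (N : ℝ) + 1 := by linarith
      rw [if_pos h', if_neg (not_le.2 h')]
      have hN : (1 : ℝ) ≤ N := by
        have : (0 : ℝ) < N := by linarith
        exact_mod_cast this
      linarith [powLogDensity_add_one_le hα ha hA hN]

lemma one_le_elias (x : ℕ+) : 1 ≤ elias x := by
  have h1 : (1 : ℝ) ≤ (x : ℝ) := by exact_mod_cast x.pos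
  have h2 := Real.logb_nonneg one_lt_two h1
  have h3 : 0 ≤ Real.logb 2 (1 + Real.logb 2 (x : ℝ)) :=
    Real.logb_nonneg one_lt_two (by linarith)
  have : (1 : ℤ) ≤ ⌊Real.logb 2 (x : ℝ) + 2 * Real.logb 2 (1 + Real.logb 2 (x : ℝ)) + 1⌋ :=
    Int.le_floor.2 (by push_cast; linarith)
  unfold elias
  exact_mod_cast this

lemma exists_elias_le_log : ∃ A : ℝ, ∀ x : ℕ+,
    elias x ≤ 3 / 2 / Real.log 2 * Real.log x + A := by
  have hl2 : 0 < Real.log 2 := Real.log_pos one_lt_two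
  set c : ℝ := 4 / Real.log 2 with hc
  have hc0 : 0 < c := by positivity
  refine ⟨1 / 2 + 2 / Real.log 2 * Real.log c + 1, fun x => ?_⟩
  have h1 : (1 : ℝ) ≤ (x : ℝ) := by exact_mod_cast x.pos
  have h2 := Real.logb_nonneg one_lt_two h1
  set u := Real.logb 2 (x : ℝ) with hu
  have h3 := Real.log_le_sub_one_of_pos (x := (1 + u) / c) (by positivity)
  rw [Real.log_div (by positivity) hc0.ne'] at h3
  have h4 : Real.log (1 + u) ≤ (1 + u) / c + Real.log c := by linarith
  have h5 : 2 * Real.logb 2 (1 + u) ≤ (1 + u) / 2 + 2 / Real.log 2 * Real.log c := by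
    have := mul_le_mul_of_nonneg_left h4 (show 0 ≤ 2 / Real.log 2 by positivity)
    calc 2 * Real.logb 2 (1 + u) = 2 / Real.log 2 * Real.log (1 + u) := by
          rw [Real.logb]; ring
      _ ≤ _ := this
      _ = _ := by rw [mul_add, hc]; field_simp; norm_num
  have h6 : elias x ≤ u + 2 * Real.logb 2 (1 + u) + 1 := Int.floor_le _
  have h7 : 3 / 2 / Real.log 2 * Real.log x = 3 / 2 * u := by
    rw [hu, Real.logb]; ring
  rw [h7]
  linarith

lemma sum_Icc_rpow_sub_one_le {s : ℝ} (hs : 0 < s) (hs1 : s ≤ 1) (n : ℕ) :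
    ∑ j ∈ Finset.Icc 1 n, (j : ℝ) ^ (s - 1) ≤ (n : ℝ) ^ s / s := by
  induction n with
  | zero => simp [Real.zero_rpow hs.ne']
  | succ n ih =>
    rw [Finset.sum_Icc_succ_top (by omega)]
    have hm : (0 : ℝ) < (n : ℝ) + 1 := by positivity
    have hb := rpow_one_add_le_one_add_mul_self (s := -1 / ((n : ℝ) + 1)) (p := s)
      (by rw [le_div_iff₀ hm]; linarith [(Nat.cast_nonneg n : (0 : ℝ) ≤ n)]) hs.le hs1
    have he : 1 + -1 / ((n : ℝ) + 1) = n / (n + 1) := by field_simp; ring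
    rw [he, Real.div_rpow (by positivity) hm.le, div_le_iff₀ (by positivity)] at hb
    push_cast
    rw [le_div_iff₀ hs] at ih ⊢
    rw [Real.rpow_sub_one hm.ne', add_mul]
    have : (1 + s * (-1 / ((n : ℝ) + 1))) * ((n : ℝ) + 1) ^ s =
      ((n : ℝ) + 1) ^ s - ((n : ℝ) + 1) ^ s / (n + 1) * s := by ring
    linarith

lemma tsum_indicator_mul_elias_le {α C a A K : ℝ} (hα : 1 < α) (hC : 0 < C) (ha : 0 ≤ a)
    (hA : a ≤ A) (hK : 0 < K) (hE : ∀ x : ℕ+, elias x ≤ a * Real.log x + A)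
    {p : ℕ+ → ℝ} (hp0 : ∀ x, 0 ≤ p x) (hp : ∀ x : ℕ+, p x ≤ C / (x : ℝ) ^ α) :
    ∑' x : ℕ+, Set.indicator {x : ℕ+ | K < (x : ℝ)} (fun x => p x * elias x) x ≤
      C * (powLogDensity α a A (max 1 K) + powLogTail α a A (max 1 K)) := by
  have h0 : ∀ x, 0 ≤ p x * elias x :=
    fun x => mul_nonneg (hp0 x) (zero_le_one.trans (one_le_elias x))
  have h1 : ∀ x : ℕ+, p x * elias x ≤ C * powLogDensity α a A x := fun x => by
    have hx : (0 : ℝ) < x := by exact_mod_cast x.pos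
    calc p x * elias x ≤ C / (x : ℝ) ^ α * (a * Real.log x + A) :=
          mul_le_mul (hp x) (hE x) (zero_le_one.trans (one_le_elias x)) (by positivity)
      _ = _ := by rw [powLogDensity, Real.rpow_neg hx.le]; ring
  have hM : (1 : ℝ) ≤ max 1 K := le_max_left _ _
  have hA0 := ha.trans hA
  rw [← Equiv.pnatEquivNat.symm.tsum_eq]
  refine Real.tsum_le_of_sum_range_le (fun i => Set.indicator_nonneg (fun x _ => h0 x) _)
    fun N => ?_
  calc _ ≤ ∑ i ∈ Finset.range N,
        C * (if K < (i : ℝ) + 1 then powLogDensity α a A (i + 1) else 0) := by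
        refine Finset.sum_le_sum fun i _ => ?_
        have hi := h1 (Equiv.pnatEquivNat.symm i)
        by_cases h : K < (i : ℝ) + 1
        · simpa [Set.indicator_apply, h] using hi
        · simp [h]
    _ ≤ _ := by
        rw [← Finset.mul_sum]
        refine mul_le_mul_of_nonneg_left
          ((sum_range_powLogDensity_le hα ha hA hK N).trans ?_) hC.le
        split_ifs with h
        · exact add_nonneg (powLogDensity_nonneg ha hA0 hM) (powLogTail_nonneg hα ha hA0 hM)
        · have hN : (1 : ℝ) ≤ N := by
            have : (0 : ℝ) < N := by linarith
            exact_mod_cast this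
          linarith [powLogTail_nonneg hα ha hA0 hN]

lemma powLogDensity_max_add_powLogTail_max_le {α a A K T : ℝ} (hα : 1 < α) (ha : 0 ≤ a)
    (hA : 0 ≤ A) (hK : 0 < K) (hT : Real.log (max 1 K) ≤ T) :
    powLogDensity α a A (max 1 K) + powLogTail α a A (max 1 K) ≤
      K ^ (-α) * (a * T + A) +
        K ^ (1 - α) * (a * T / (α - 1) + (A + a / (α - 1)) / (α - 1)) := by
  have hb : 0 < α - 1 := by linarith
  have hl : 0 ≤ Real.log (max 1 K) := Real.log_nonneg (le_max_left _ _)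
  have h1 : (max 1 K) ^ (-α) ≤ K ^ (-α) :=
    Real.rpow_le_rpow_of_nonpos hK (le_max_right _ _) (by linarith)
  have h2 : (max 1 K) ^ (1 - α) ≤ K ^ (1 - α) :=
    Real.rpow_le_rpow_of_nonpos hK (le_max_right _ _) (by linarith)
  unfold powLogDensity powLogTail
  gcongr

lemma eventually_rpow_mul_log_add_le {s κ : ℝ} (hs : 0 < s) (hκ : 0 < κ) (c₁ c₂ c₃ : ℝ) :
    ∀ᶠ n : ℕ in Filter.atTop,
      (n : ℝ) ^ (s / 2) * (c₁ * Real.log n + c₂) + c₃ * (n : ℝ) ^ s ≤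
        κ * ((n : ℝ) ^ s * Real.log n) := by
  have hlog : Filter.Tendsto (fun n : ℕ => Real.log n) Filter.atTop Filter.atTop :=
    Real.tendsto_log_atTop.comp tendsto_natCast_atTop_atTop
  have hpow : Filter.Tendsto (fun n : ℕ => (n : ℝ) ^ (s / 2)) Filter.atTop Filter.atTop :=
    (tendsto_rpow_atTop (by positivity)).comp tendsto_natCast_atTop_atTop
  filter_upwards [hlog.eventually_ge_atTop 1, hlog.eventually_ge_atTop (2 * c₃ / κ),
    hpow.eventually_ge_atTop (2 * (c₁ + |c₂|) / κ), Filter.eventually_gt_atTop 0]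
    with n h1 h2 h3 hn
  have hn' : (0 : ℝ) < n := by exact_mod_cast hn
  have hsq : (n : ℝ) ^ s = (n : ℝ) ^ (s / 2) * (n : ℝ) ^ (s / 2) := by
    rw [← Real.rpow_add hn']; congr 1; ring
  rw [div_le_iff₀ hκ] at h2 h3
  rw [hsq]
  have hq : 0 < (n : ℝ) ^ (s / 2) := by positivity
  set q := (n : ℝ) ^ (s / 2)
  set L := Real.log n
  have h4 : c₁ * L + c₂ ≤ (c₁ + |c₂|) * L := by
    nlinarith [le_abs_self c₂, abs_nonneg c₂]
  have h5 : (c₁ + |c₂|) * L ≤ q * κ / 2 * L := by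
    apply mul_le_mul_of_nonneg_right <;> linarith
  have h6 := mul_le_mul_of_nonneg_left (h4.trans h5) hq.le
  have h7 := mul_le_mul_of_nonneg_left h2 (mul_pos hq hq).le
  linarith

/-- asymptotic upper bound on the expected total Elias codelength of the
censored symbols, uniformly over the power-law envelope class:
`limsup_n sup_p L_n(p) / (n^{1/α} log n) ≤ 2C/((α-1) λ^{α-1})`. -/
theorem stmt15 (alpha C lam : ℝ) (halpha : 1 < alpha) (hC : 0 < C) (hlam : 0 < lam)
    (eps : ℝ) (heps : 0 < eps) :
    ∀ᶠ n : ℕ in Filter.atTop,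
      ∀ p : ℕ+ → ℝ, IsPmf p → (∀ x : ℕ+, p x ≤ C / (x : ℝ) ^ alpha) →
        (∑ j ∈ Finset.Icc 1 n, ∑' x : ℕ+,
            Set.indicator {x : ℕ+ | lam * (j : ℝ) ^ (1 / alpha) < (x : ℝ)}
              (fun x => p x * elias x) x) ≤
          (2 * C / ((alpha - 1) * lam ^ (alpha - 1)) + eps) *
            ((n : ℝ) ^ (1 / alpha) * Real.logb 2 (n : ℝ)) := by
  obtain ⟨A₀, hA₀⟩ := exists_elias_le_log
  have hl2 : 0 < Real.log 2 := Real.log_pos one_lt_two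
  have hb : 0 < alpha - 1 := by linarith
  have hα0 : 0 < alpha := by linarith
  set a : ℝ := 3 / 2 / Real.log 2 with ha_def
  have ha : 0 < a := by positivity
  set A := max A₀ a
  have hA : a ≤ A := le_max_right _ _
  have hA0 : 0 < A := ha.trans_le hA
  have hE : ∀ x : ℕ+, elias x ≤ a * Real.log x + A := fun x =>
    (hA₀ x).trans (by linarith [le_max_left A₀ a])
  set s := 1 / alpha with hs_def
  have hs : 0 < s := by positivity
  have hs1 : s ≤ 1 := by rw [hs_def, div_le_one hα0]; linarith
  have hsα : s * alpha = 1 := by rw [hs_def]; field_simp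
  set D := C / ((alpha - 1) * lam ^ (alpha - 1)) with hD_def
  have hD : 0 < D := by positivity
  set w := |Real.log lam|
  set B := (A + a / (alpha - 1)) / (alpha - 1)
  filter_upwards [eventually_rpow_mul_log_add_le hs (κ := eps / Real.log 2) (by positivity)
      (C * lam ^ (-alpha) * (2 * alpha) * (a * s))
      (C * lam ^ (-alpha) * (2 * alpha) * (a * w + A))
      (C * lam ^ (1 - alpha) * alpha * (a * w / (alpha - 1) + B)),
    Filter.eventually_gt_atTop 0] with n hn hn0 p hp hpC
  have hn1 : (1 : ℝ) ≤ n := by exact_mod_cast hn0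
  have hL : 0 ≤ Real.log n := Real.log_nonneg hn1
  set T := s * Real.log n + w with hT_def
  have hT : 0 ≤ T := by positivity
  have hterm : ∀ j ∈ Finset.Icc 1 n,
      ∑' x : ℕ+, Set.indicator {x : ℕ+ | lam * (j : ℝ) ^ s < (x : ℝ)}
        (fun x => p x * elias x) x ≤
      C * lam ^ (-alpha) * (a * T + A) * (j : ℝ) ^ (s / 2 - 1) +
        C * lam ^ (1 - alpha) * (a * T / (alpha - 1) + B) * (j : ℝ) ^ (s - 1) := by
    intro j hj
    rw [Finset.mem_Icc] at hj
    have hj1 : (1 : ℝ) ≤ j := by exact_mod_cast hj.1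
    have hj0 : (0 : ℝ) < j := by linarith
    have hjn : (j : ℝ) ≤ n := by exact_mod_cast hj.2
    have hK : 0 < lam * (j : ℝ) ^ s := by positivity
    have hlogK : Real.log (max 1 (lam * (j : ℝ) ^ s)) ≤ T := by
      rcases max_cases 1 (lam * (j : ℝ) ^ s) with h | h
      · rw [h.1, Real.log_one]; exact hT
      · rw [h.1, Real.log_mul hlam.ne' (by positivity), Real.log_rpow hj0]
        have := mul_le_mul_of_nonneg_left (Real.log_le_log hj0 hjn) hs.le
        linarith [le_abs_self (Real.log lam)]
    have e1 : (lam * (j : ℝ) ^ s) ^ (-alpha) ≤ lam ^ (-alpha) * (j : ℝ) ^ (s / 2 - 1) := by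
      rw [Real.mul_rpow hlam.le (by positivity), ← Real.rpow_mul hj0.le]
      gcongr
      linarith
    have e2 : (lam * (j : ℝ) ^ s) ^ (1 - alpha) = lam ^ (1 - alpha) * (j : ℝ) ^ (s - 1) := by
      rw [Real.mul_rpow hlam.le (by positivity), ← Real.rpow_mul hj0.le]
      congr 2
      linarith
    calc _ ≤ _ := tsum_indicator_mul_elias_le halpha hC ha.le hA hK hE hp.1 hpC
      _ ≤ C * _ := mul_le_mul_of_nonneg_left
          (powLogDensity_max_add_powLogTail_max_le halpha ha.le hA0.le hK hlogK) hC.le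
      _ ≤ C * (lam ^ (-alpha) * (j : ℝ) ^ (s / 2 - 1) * (a * T + A) +
          lam ^ (1 - alpha) * (j : ℝ) ^ (s - 1) * (a * T / (alpha - 1) + B)) := by
          rw [e2]
          gcongr
      _ = _ := by ring
  have hS1 := sum_Icc_rpow_sub_one_le (half_pos hs) (by linarith) n
  have hS2 := sum_Icc_rpow_sub_one_le hs hs1 n
  have hsi : ∀ y : ℝ, y / s = alpha * y := fun y => by rw [hs_def]; field_simp
  have hsi2 : ∀ y : ℝ, y / (s / 2) = 2 * alpha * y := fun y => by rw [hs_def]; field_simp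
  rw [hsi] at hS2
  rw [hsi2] at hS1
  have hB : 0 ≤ B := by positivity
  have hlamD : C * lam ^ (1 - alpha) / (alpha - 1) = D := by
    rw [hD_def, show 1 - alpha = -(alpha - 1) by ring, Real.rpow_neg hlam.le]
    field_simp
  calc _ ≤ _ := Finset.sum_le_sum hterm
    _ ≤ C * lam ^ (-alpha) * (a * T + A) * (2 * alpha * (n : ℝ) ^ (s / 2)) +
        C * lam ^ (1 - alpha) * (a * T / (alpha - 1) + B) * (alpha * (n : ℝ) ^ s) := by
        rw [Finset.sum_add_distrib, ← Finset.mul_sum, ← Finset.mul_sum]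
        gcongr
    _ = ((n : ℝ) ^ (s / 2) * (C * lam ^ (-alpha) * (2 * alpha) * (a * s) * Real.log n +
          C * lam ^ (-alpha) * (2 * alpha) * (a * w + A)) +
        C * lam ^ (1 - alpha) * alpha * (a * w / (alpha - 1) + B) * (n : ℝ) ^ s) +
        C * lam ^ (1 - alpha) / (alpha - 1) * (s * alpha) * a *
          ((n : ℝ) ^ s * Real.log n) := by
        rw [hT_def]; ring
    _ ≤ eps / Real.log 2 * ((n : ℝ) ^ s * Real.log n) +
        D * a * ((n : ℝ) ^ s * Real.log n) := by
        rw [hlamD, hsα, mul_one]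
        gcongr
    _ = eps / Real.log 2 * ((n : ℝ) ^ s * Real.log n) +
        3 / 2 * (D * ((n : ℝ) ^ s * Real.log n) / Real.log 2) := by
        rw [ha_def]; ring
    _ ≤ eps / Real.log 2 * ((n : ℝ) ^ s * Real.log n) +
        2 * (D * ((n : ℝ) ^ s * Real.log n) / Real.log 2) := by
        gcongr; norm_num
    _ = _ := by
        rw [mul_div_assoc 2 C, ← hD_def, Real.logb]; ring
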